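/- Let G' be a finite directed graph on M vertices with neighbor sets N_k, and let H be the M×M complex matrix with [H]_{kk} = −|N_k|, [H]_{kj} = e^{−i θ_{jk}} for j ∈ N_k (0 otherwise), where the phases satisfy θ_{jk} ≡ θ_j − θ_k (mod 2π) for fixed angles θ_1,…,θ_M. Then zero is a simple eigenvalue of H with corresponding eigenvector z = (e^{i θ_1},…,e^{i θ_M})^T if and only if G' has an oriented spanning tree, and in that case every nonzero eigenvalue of H has strictly negative real part. -/

import Mathlib

open Complex Matrix Polynomial

section Reachability

variable {V : Type*} [Fintype V] {N : V → Finset V}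

/-- Maximum principle: a subharmonic function attains its maximum at every vertex reachable
from all others. -/
lemma le_root_of_subharmonic {x : V → ℝ} (hx : ∀ k, 0 ≤ ∑ j ∈ N k, (x j - x k)) {r : V}
    (hr : ∀ k, Relation.ReflTransGen (fun a b => b ∈ N a) k r) (k : V) : x k ≤ x r := by
  obtain ⟨m, -, hm⟩ := Finset.exists_max_image Finset.univ x ⟨r, Finset.mem_univ r⟩
  have hstep : ∀ a, Relation.ReflTransGen (fun a b => b ∈ N a) m a → x a = x m := by
    intro a ha
    induction ha with
    | refl => rfl
    | @tail b c _ hbc ih =>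
      have hle : ∀ j ∈ N b, x j - x b ≤ 0 := fun j _ => by
        linarith [hm j (Finset.mem_univ j)]
      have hzero := (Finset.sum_eq_zero_iff_of_nonpos hle).1
        (le_antisymm (Finset.sum_nonpos hle) (hx b)) c hbc
      linarith
  rw [hstep r (hr m)]
  exact hm k (Finset.mem_univ k)

lemma eq_root_of_harmonic {x : V → ℝ} (hx : ∀ k, ∑ j ∈ N k, (x j - x k) = 0) {r : V}
    (hr : ∀ k, Relation.ReflTransGen (fun a b => b ∈ N a) k r) (k : V) : x k = x r := by
  refine le_antisymm (le_root_of_subharmonic (fun k => (hx k).ge) hr k) ?_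
  have h := le_root_of_subharmonic (N := N) (x := fun k => -x k) (fun k => ?_) hr k
  · simpa using h
  · have := hx k
    rw [← neg_eq_zero, ← Finset.sum_neg_distrib] at this
    exact (this.symm.trans (Finset.sum_congr rfl fun j _ => by ring)).le

lemma sum_sub_nonpos_of_forall_eq [Nonempty V] {x : V → ℝ} {c : ℝ}
    (hx : ∀ k, ∑ j ∈ N k, (x j - x k) = c) : c ≤ 0 := by
  obtain ⟨m, hm⟩ := Finite.exists_max x
  rw [← hx m]
  exact Finset.sum_nonpos fun j _ => sub_nonpos.2 (hm j)

lemma sum_sub_eq_zero_of_forall_eq [Nonempty V] {x : V → ℝ} {c : ℝ}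
    (hx : ∀ k, ∑ j ∈ N k, (x j - x k) = c) : c = 0 := by
  refine le_antisymm (sum_sub_nonpos_of_forall_eq hx) ?_
  have h := sum_sub_nonpos_of_forall_eq (N := N) (x := fun k => -x k) (c := -c) fun k => by
    rw [← hx k, ← Finset.sum_neg_distrib]
    exact Finset.sum_congr rfl fun j _ => by ring
  linarith

/-- A finite directed graph without a vertex reachable from all others has two disjoint nonempty
sets of vertices closed under out-neighbours. -/
lemma exists_disjoint_closed [Nonempty V]
    (h : ¬ ∃ r, ∀ k, Relation.ReflTransGen (fun a b => b ∈ N a) k r) :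
    ∃ S T : Finset V, S.Nonempty ∧ T.Nonempty ∧ (∀ k ∈ S, N k ⊆ S) ∧ (∀ k ∈ T, N k ⊆ T) ∧
      Disjoint S T := by
  classical
  let R : V → Finset V := fun k => {j | Relation.ReflTransGen (fun a b => b ∈ N a) k j}
  have hR : ∀ {k j}, j ∈ R k ↔ Relation.ReflTransGen (fun a b => b ∈ N a) k j := by simp [R]
  have hclosed : ∀ m, ∀ k ∈ R m, N k ⊆ R m := fun m k hk j hj => hR.2 ((hR.1 hk).tail hj)
  have hself : ∀ k, k ∈ R k := fun k => hR.2 .refl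
  obtain ⟨k, hk⟩ := Finite.exists_min fun k => (R k).card
  push Not at h
  obtain ⟨m, hm⟩ := h k
  refine ⟨R k, R m, ⟨k, hself k⟩, ⟨m, hself m⟩, hclosed k, hclosed m, ?_⟩
  refine Finset.disjoint_left.2 fun j hjk hjm => hm ?_
  have hsub : R j ⊆ R k := fun i hi => hR.2 ((hR.1 hjk).trans (hR.1 hi))
  have hkj : k ∈ R j := Finset.eq_of_subset_of_card_le hsub (hk j) ▸ hself k
  exact (hR.1 hjm).trans (hR.1 hkj)

end Reachability

section NegLaplacian

variable {V : Type*} [DecidableEq V] {N : V → Finset V}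

/-- The negative of the Laplacian of the directed graph in which `N k` is the set of
out-neighbours of `k`. -/
def negLaplacian (N : V → Finset V) : Matrix V V ℂ :=
  Matrix.of fun k j => if j = k then -((N k).card : ℂ) else if j ∈ N k then 1 else 0

lemma negLaplacian_apply_eq_zero {k j : V} (hjk : j ≠ k) (hj : j ∉ N k) :
    negLaplacian N k j = 0 := by
  simp [negLaplacian, hjk, hj]

variable [Fintype V]

lemma negLaplacian_mulVec_apply (hN : ∀ k, k ∉ N k) (v : V → ℂ) (k : V) :
    (negLaplacian N *ᵥ v) k = ∑ j ∈ N k, (v j - v k) := by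
  have h : ∀ j, negLaplacian N k j * v j =
      (if j = k then -((N k).card : ℂ) * v k else 0) + (if j ∈ N k then v j else 0) := by
    intro j
    by_cases hj : j = k
    · subst hj
      simp [negLaplacian, hN]
    · simp [negLaplacian, hj]
  simp only [Matrix.mulVec, dotProduct, h, Finset.sum_add_distrib, Finset.sum_sub_distrib]
  simp
  ring

lemma eq_root_of_negLaplacian_mulVec_eq_zero (hN : ∀ k, k ∉ N k) {v : V → ℂ}
    (hv : negLaplacian N *ᵥ v = 0) {r : V}
    (hr : ∀ k, Relation.ReflTransGen (fun a b => b ∈ N a) k r) (k : V) : v k = v r := by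
  have h : ∀ k, ∑ j ∈ N k, (v j - v k) = 0 := fun k => by
    rw [← negLaplacian_mulVec_apply hN, hv, Pi.zero_apply]
  apply Complex.ext
  · exact eq_root_of_harmonic (x := fun k => (v k).re)
      (fun k => by simpa using congrArg Complex.re (h k)) hr k
  · exact eq_root_of_harmonic (x := fun k => (v k).im)
      (fun k => by simpa using congrArg Complex.im (h k)) hr k

lemma eq_zero_of_negLaplacian_mulVec_eq_const [Nonempty V] (hN : ∀ k, k ∉ N k) {v : V → ℂ}
    {c : ℂ} (hv : ∀ k, (negLaplacian N *ᵥ v) k = c) : c = 0 := by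
  simp only [negLaplacian_mulVec_apply hN] at hv
  apply Complex.ext
  · exact sum_sub_eq_zero_of_forall_eq (N := N) (x := fun k => (v k).re)
      (fun k => by simpa using congrArg Complex.re (hv k))
  · exact sum_sub_eq_zero_of_forall_eq (N := N) (x := fun k => (v k).im)
      (fun k => by simpa using congrArg Complex.im (hv k))

lemma negLaplacian_mulVec_eq_zero_of_pow (hN : ∀ k, k ∉ N k) {r : V}
    (hr : ∀ k, Relation.ReflTransGen (fun a b => b ∈ N a) k r) (n : ℕ) {v : V → ℂ}
    (hv : (negLaplacian N ^ n) *ᵥ v = 0) : negLaplacian N *ᵥ v = 0 := by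
  have : Nonempty V := ⟨r⟩
  induction n generalizing v with
  | zero => simp_all
  | succ n ih =>
    rw [pow_succ, ← Matrix.mulVec_mulVec] at hv
    have hconst := eq_root_of_negLaplacian_mulVec_eq_zero hN (ih hv) hr
    have hzero := eq_zero_of_negLaplacian_mulVec_eq_const hN hconst
    ext k
    rw [hconst k, hzero, Pi.zero_apply]

lemma negLaplacian_mulVec_one (hN : ∀ k, k ∉ N k) : negLaplacian N *ᵥ 1 = 0 := by
  ext k
  simp [negLaplacian_mulVec_apply hN]

lemma rootMultiplicity_zero_charpoly_negLaplacian_eq_one (hN : ∀ k, k ∉ N k) {r : V}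
    (hr : ∀ k, Relation.ReflTransGen (fun a b => b ∈ N a) k r) :
    (negLaplacian N).charpoly.rootMultiplicity 0 = 1 := by
  rw [← Matrix.charpoly_toLin', ← LinearMap.finrank_maxGenEigenspace_eq]
  have hmem : (1 : V → ℂ) ∈ Module.End.maxGenEigenspace (negLaplacian N).toLin' 0 := by
    rw [Module.End.mem_maxGenEigenspace]
    exact ⟨1, by simp [negLaplacian_mulVec_one hN]⟩
  refine finrank_eq_one ⟨1, hmem⟩ (fun h => ?_) fun ⟨w, hw⟩ => ⟨w r, ?_⟩
  · exact one_ne_zero (congrFun (congrArg Subtype.val h) r)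
  · obtain ⟨n, hn⟩ := (Module.End.mem_maxGenEigenspace _ _ _).1 hw
    rw [zero_smul, sub_zero, ← Matrix.toLin'_pow, Matrix.toLin'_apply] at hn
    have hconst := eq_root_of_negLaplacian_mulVec_eq_zero hN
      (negLaplacian_mulVec_eq_zero_of_pow hN hr n hn) hr
    ext k
    simp [hconst k]

/-- A nonempty set of vertices closed under out-neighbours supports a left null vector of the
Laplacian. -/
lemma exists_vecMul_negLaplacian_eq_zero (hN : ∀ k, k ∉ N k) {S : Finset V} (hne : S.Nonempty)
    (hS : ∀ k ∈ S, N k ⊆ S) :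
    ∃ y : V → ℂ, y ≠ 0 ∧ (∀ i ∉ S, y i = 0) ∧ y ᵥ* negLaplacian N = 0 := by
  have hA : ∀ i ∈ S, ∀ j ∉ S, negLaplacian N i j = 0 := fun i hi j hj =>
    negLaplacian_apply_eq_zero (fun h => hj (h ▸ hi)) fun h => hj (hS i hi h)
  have hdet : ((negLaplacian N).submatrix ((↑) : S → V) (↑)).det = 0 := by
    rw [← Matrix.exists_mulVec_eq_zero_iff]
    obtain ⟨s, hs⟩ := hne
    refine ⟨1, fun h => one_ne_zero (congrFun h ⟨s, hs⟩), ?_⟩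
    ext ⟨i, hi⟩
    have h := congrFun (negLaplacian_mulVec_one hN) i
    simp only [Matrix.mulVec, dotProduct, Pi.one_apply, mul_one, Pi.zero_apply,
      Matrix.submatrix_apply] at h ⊢
    rw [Finset.sum_coe_sort S fun j => negLaplacian N i j, ← h]
    exact Finset.sum_subset (Finset.subset_univ S) fun j _ hj => hA i hi j hj
  obtain ⟨u, hu, huA⟩ := Matrix.exists_vecMul_eq_zero_iff.2 hdet
  refine ⟨fun i => if h : i ∈ S then u ⟨i, h⟩ else 0, fun h => hu ?_,
    fun i hi => dif_neg hi, ?_⟩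
  · ext ⟨i, hi⟩
    simpa [hi] using congrFun h i
  · ext j
    have hsum : ((fun i => if h : i ∈ S then u ⟨i, h⟩ else 0) ᵥ* negLaplacian N) j =
        ∑ i : S, u i * negLaplacian N i j := by
      simp only [Matrix.vecMul, dotProduct]
      rw [← Finset.sum_subset (Finset.subset_univ S) fun i _ hi => by simp [hi],
        ← Finset.sum_coe_sort S]
      simp
    rw [hsum, Pi.zero_apply]
    by_cases hj : j ∈ S
    · exact congrFun huA ⟨j, hj⟩
    · exact Finset.sum_eq_zero fun i _ => by rw [hA i i.2 j hj, mul_zero]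

lemma one_lt_rootMultiplicity_zero_charpoly_negLaplacian (hN : ∀ k, k ∉ N k) {S T : Finset V}
    (hSne : S.Nonempty) (hTne : T.Nonempty) (hS : ∀ k ∈ S, N k ⊆ S) (hT : ∀ k ∈ T, N k ⊆ T)
    (hST : Disjoint S T) : 1 < (negLaplacian N).charpoly.rootMultiplicity 0 := by
  obtain ⟨y, hy, hyS, hyA⟩ := exists_vecMul_negLaplacian_eq_zero hN hSne hS
  obtain ⟨w, hw, hwT, hwA⟩ := exists_vecMul_negLaplacian_eq_zero hN hTne hT
  rw [← Matrix.charpoly_transpose, ← Matrix.charpoly_toLin']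
  refine lt_of_lt_of_le ?_ (LinearMap.finrank_eigenspace_le _ _)
  by_contra! hle
  obtain ⟨⟨v, _⟩, hv⟩ := finrank_le_one_iff.1 hle
  have hmem : ∀ x : V → ℂ, x ᵥ* negLaplacian N = 0 →
      x ∈ Module.End.eigenspace (negLaplacian N)ᵀ.toLin' 0 := fun x hx => by
    simp [Matrix.mulVec_transpose, hx]
  obtain ⟨a, ha⟩ := hv ⟨y, hmem y hyA⟩
  obtain ⟨b, hb⟩ := hv ⟨w, hmem w hwA⟩
  have hay : ∀ i, a * v i = y i := fun i => congrFun (congrArg Subtype.val ha) i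
  have hbw : ∀ i, b * v i = w i := fun i => congrFun (congrArg Subtype.val hb) i
  obtain ⟨i, hi⟩ := Function.ne_iff.1 hy
  obtain ⟨j, hj⟩ := Function.ne_iff.1 hw
  have hiT : i ∉ T := Finset.disjoint_left.1 hST (by_contra fun h => hi (hyS i h))
  have hbi := (hbw i).trans (hwT i hiT)
  rcases mul_eq_zero.1 hbi with h | h
  · exact hj (by rw [← hbw, h, zero_mul, Pi.zero_apply])
  · exact hi (by rw [← hay, h, mul_zero, Pi.zero_apply])

/-- Zero is a simple root of the characteristic polynomial of the Laplacian of a directed graph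
iff some vertex is reachable from all others. -/
lemma rootMultiplicity_zero_charpoly_negLaplacian_eq_one_iff [Nonempty V] (hN : ∀ k, k ∉ N k) :
    (negLaplacian N).charpoly.rootMultiplicity 0 = 1 ↔
      ∃ r, ∀ k, Relation.ReflTransGen (fun a b => b ∈ N a) k r := by
  refine ⟨fun h => ?_, fun ⟨r, hr⟩ => rootMultiplicity_zero_charpoly_negLaplacian_eq_one hN hr⟩
  by_contra hno
  obtain ⟨S, T, hSne, hTne, hS, hT, hST⟩ := exists_disjoint_closed hno
  exact (one_lt_rootMultiplicity_zero_charpoly_negLaplacian hN hSne hTne hS hT hST).ne' h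

/-- Every nonzero eigenvalue of the negative Laplacian has negative real part. -/
lemma re_neg_of_isRoot_charpoly_negLaplacian (hN : ∀ k, k ∉ N k) {μ : ℂ}
    (hμ : (negLaplacian N).charpoly.IsRoot μ) (hμ0 : μ ≠ 0) : μ.re < 0 := by
  rw [← Matrix.charpoly_toLin', ← Module.End.hasEigenvalue_iff_isRoot_charpoly] at hμ
  obtain ⟨k, hk⟩ := eigenvalue_mem_ball hμ
  have hsum : ∑ j ∈ Finset.univ.erase k, ‖negLaplacian N k j‖ = (N k).card := by
    have h : ∀ j ∈ Finset.univ.erase k, ‖negLaplacian N k j‖ = if j ∈ N k then 1 else 0 := by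
      intro j hj
      have hjk := Finset.ne_of_mem_erase hj
      by_cases hjN : j ∈ N k <;> simp [negLaplacian, hjk, hjN]
    rw [Finset.sum_congr rfl h, Finset.sum_erase _ (by simp [hN])]
    simp
  have hdiag : negLaplacian N k k = -((N k).card : ℂ) := by simp [negLaplacian]
  rw [Metric.mem_closedBall, dist_eq_norm, hsum, hdiag, sub_neg_eq_add] at hk
  have hsq : ‖μ + ((N k).card : ℂ)‖ ^ 2 ≤ ((N k).card : ℝ) ^ 2 := by gcongr
  rw [← Complex.normSq_eq_norm_sq, Complex.normSq_apply] at hsq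
  simp only [Complex.add_re, Complex.add_im, Complex.natCast_re, Complex.natCast_im,
    add_zero] at hsq
  by_contra! hre
  have hprod : 0 ≤ μ.re * ((N k).card : ℝ) := by positivity
  apply hμ0
  apply Complex.ext
  · rw [Complex.zero_re]
    nlinarith [mul_self_nonneg μ.re, mul_self_nonneg μ.im]
  · rw [Complex.zero_im]
    nlinarith [mul_self_nonneg μ.re, mul_self_nonneg μ.im]

end NegLaplacian

/-- Zero is a simple eigenvalue of the phase-coupled matrix `H` with eigenvector
`z = (e^{iθ_1},…,e^{iθ_M})` iff the directed graph with neighbor sets `N_k` has an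
oriented spanning tree; and in that case every nonzero eigenvalue of `H` has strictly
negative real part. -/
theorem zero_simple_eigenvalue_iff_ost (M : ℕ) [NeZero M]
    (N : Fin M → Finset (Fin M)) (hNk : ∀ k, k ∉ N k)
    (θ : Fin M → ℝ) (θjk : Fin M → Fin M → ℝ)
    (hcompat : ∀ k, ∀ j ∈ N k,
      Complex.exp (Complex.I * θjk j k) = Complex.exp (Complex.I * (θ j - θ k)))
    (H : Matrix (Fin M) (Fin M) ℂ)
    (hH : ∀ k j, H k j =
      if j = k then -((N k).card : ℂ)
      else if j ∈ N k then Complex.exp (-(Complex.I * θjk j k)) else 0)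
    (z : Fin M → ℂ) (hz : ∀ k, z k = Complex.exp (Complex.I * θ k)) :
    (((H.charpoly.rootMultiplicity 0 = 1) ∧ H.mulVec z = 0) ↔
      ∃ r : Fin M, ∀ k : Fin M, Relation.ReflTransGen (fun a b => b ∈ N a) k r) ∧
    ((∃ r : Fin M, ∀ k : Fin M, Relation.ReflTransGen (fun a b => b ∈ N a) k r) →
      ∀ μ ∈ H.charpoly.roots, μ ≠ 0 → μ.re < 0) := by
  have hz0 : ∀ k, z k ≠ 0 := fun k => by
    rw [hz]
    exact Complex.exp_ne_zero _
  have hconj : H = Matrix.diagonal z * negLaplacian N * Matrix.diagonal (fun k => (z k)⁻¹) := by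
    ext k j
    rw [Matrix.mul_diagonal, Matrix.diagonal_mul, hH]
    by_cases hjk : j = k
    · subst hjk
      simp [negLaplacian, mul_right_comm _ _ (z j)⁻¹, hz0 j]
    · by_cases hj : j ∈ N k
      · simp only [negLaplacian, Matrix.of_apply, hjk, hj, if_true, if_false, mul_one]
        rw [Complex.exp_neg, hcompat k j hj, ← Complex.exp_neg, hz, hz, ← Complex.exp_neg,
          ← Complex.exp_add]
        congr 1
        ring
      · simp [negLaplacian, hjk, hj]
  have hinv : Matrix.diagonal (fun k => (z k)⁻¹) * Matrix.diagonal z = 1 := by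
    simp [Matrix.diagonal_mul_diagonal, hz0]
  have hchar : H.charpoly = (negLaplacian N).charpoly := by
    rw [hconj, Matrix.charpoly_mul_comm, ← mul_assoc, hinv, one_mul]
  have hHz : H *ᵥ z = 0 := by
    have hone : Matrix.diagonal (fun k => (z k)⁻¹) *ᵥ z = 1 := by
      ext k
      simp [Matrix.mulVec_diagonal, hz0]
    rw [hconj, ← Matrix.mulVec_mulVec, hone, ← Matrix.mulVec_mulVec,
      negLaplacian_mulVec_one hNk, Matrix.mulVec_zero]
  rw [hchar]
  refine ⟨?_, fun _ μ hμ hμ0 => ?_⟩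
  · rw [and_iff_left hHz]
    exact rootMultiplicity_zero_charpoly_negLaplacian_eq_one_iff hNk
  · exact re_neg_of_isRoot_charpoly_negLaplacian hNk (Polynomial.isRoot_of_mem_roots hμ) hμ0
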